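/- arXiv:1807.01416 — 7 statements merged into one kernel-verified Lean document; each statement's English description precedes it below -/
import Mathlib

section
/- Let a₁, a₂, a₃, b₁, b₂, b₃, c₁, c₂, c₃, α, β, γ be strictly positive real numbers. Define the 4 × 6 real matrix M with rows (a₁, 0, 0, 0, b₁, c₁), (0, b₂, 0, a₂, 0, c₂), (0, 0, c₃, a₃, b₃, 0), (0, 0, 0, α, β, γ), and the 2 × 6 real matrix N with rows (α b₁/a₁, −β a₂/b₂, (α b₃ − β a₃)/c₃, β, −α, 0) and ((β c₁ − γ b₁)/a₁, β c₂/b₂, −γ b₃/c₃, 0, γ, −β). Then M Nᵀ = 0, rank M = 4, and rank N = 2. -/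
open Matrix

/-- For strictly positive reals, the given 4 × 6 flux matrix `M` and the
2 × 6 matrix `N` satisfy `M Nᵀ = 0`, `rank M = 4`, and `rank N = 2`. -/
theorem flux_matrix_orthogonal_complement_basis
    (a₁ a₂ a₃ b₁ b₂ b₃ c₁ c₂ c₃ α β γ : ℝ)
    (ha₁ : 0 < a₁) (ha₂ : 0 < a₂) (ha₃ : 0 < a₃)
    (hb₁ : 0 < b₁) (hb₂ : 0 < b₂) (hb₃ : 0 < b₃)
    (hc₁ : 0 < c₁) (hc₂ : 0 < c₂) (hc₃ : 0 < c₃)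
    (hα : 0 < α) (hβ : 0 < β) (hγ : 0 < γ) :
    let M : Matrix (Fin 4) (Fin 6) ℝ :=
      !![a₁, 0, 0, 0, b₁, c₁;
         0, b₂, 0, a₂, 0, c₂;
         0, 0, c₃, a₃, b₃, 0;
         0, 0, 0, α, β, γ]
    let N : Matrix (Fin 2) (Fin 6) ℝ :=
      !![α * b₁ / a₁, -(β * a₂) / b₂, (α * b₃ - β * a₃) / c₃, β, -α, 0;
         (β * c₁ - γ * b₁) / a₁, β * c₂ / b₂, -(γ * b₃) / c₃, 0, γ, -β]
    M * Nᵀ = 0 ∧ M.rank = 4 ∧ N.rank = 2 := by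
  intro M N
  refine ⟨?_, ?_, ?_⟩
  · ext i j
    fin_cases i <;> fin_cases j <;>
      simp [M, N, Matrix.mul_apply, Fin.sum_univ_succ] <;> field_simp <;> ring
  · have h : LinearIndependent ℝ M.row := by
      rw [Fintype.linearIndependent_iff]
      intro g hg
      have h0 := congrFun hg 0
      have h1 := congrFun hg 1
      have h2 := congrFun hg 2
      have h3 := congrFun hg 3
      simp [M, Fin.sum_univ_succ, ha₁.ne'] at h0
      simp [M, Fin.sum_univ_succ, hb₂.ne'] at h1
      simp [M, Fin.sum_univ_succ, hc₃.ne'] at h2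
      simp [M, Fin.sum_univ_succ, h0, h1, h2, hα.ne'] at h3
      intro i
      fin_cases i <;> simp_all
    simpa using h.rank_matrix
  · have h : LinearIndependent ℝ N.row := by
      rw [Fintype.linearIndependent_iff]
      intro g hg
      have h0 := congrFun hg 3
      have h1 := congrFun hg 5
      simp [N, Fin.sum_univ_succ, hβ.ne'] at h0
      simp [N, Fin.sum_univ_succ, hβ.ne'] at h1
      intro i
      fin_cases i <;> simp_all
    simpa using h.rank_matrix
end

section
/- Let ℓ, m be natural numbers with ℓ + m ≥ 1. Define the functions p, q, r : ℝ³ → ℝ by p(x₁,x₂,x₃) = x₁ x₂^ℓ x₃^m − x₁/((ℓ+1)(m+1)), q(x₁,x₂,x₃) = (1/(2(ℓ+1))) x₂ (1 − x₂^ℓ)(x₃^m + 1/(m+1)), and r(x₁,x₂,x₃) = (1/(2(m+1))) x₃ (1 − x₃^m)(x₂^ℓ + 1/(ℓ+1)). Then for every point (x₁,x₂,x₃) ∈ ℝ³, the divergence ∂p/∂x₁ + ∂q/∂x₂ + ∂r/∂x₃ of the vector field ψ = (p, q, r) vanishes. -/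
theorem presup_aux (n : ℕ) (c d x : ℝ) :
    deriv (fun t : ℝ => c * t * (1 - t ^ n) * d) x = c * (1 - ((n : ℝ) + 1) * x ^ n) * d := by
  have e : (fun t : ℝ => c * t * (1 - t ^ n) * d) = fun t : ℝ => c * d * (t - t ^ (n + 1)) := by
    funext t
    ring
  rw [e]
  have h := (((hasDerivAt_id x).sub (hasDerivAt_pow (n + 1) x)).const_mul (c * d)).deriv
  refine Eq.trans h ?_
  push_cast
  ring

/-- The pre-supplemental vector field `ψ̂¹_{ℓ,m} = (p, q, r)` on ℝ³ is
divergence free when `ℓ + m ≥ 1`. -/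
theorem presupplement_divergence_free (ℓ m : ℕ) (hℓm : 1 ≤ ℓ + m)
    (p q r : ℝ → ℝ → ℝ → ℝ)
    (hp : ∀ x₁ x₂ x₃ : ℝ, p x₁ x₂ x₃ =
      x₁ * x₂ ^ ℓ * x₃ ^ m - x₁ / (((ℓ : ℝ) + 1) * ((m : ℝ) + 1)))
    (hq : ∀ x₁ x₂ x₃ : ℝ, q x₁ x₂ x₃ =
      (1 / (2 * ((ℓ : ℝ) + 1))) * x₂ * (1 - x₂ ^ ℓ) * (x₃ ^ m + 1 / ((m : ℝ) + 1)))
    (hr : ∀ x₁ x₂ x₃ : ℝ, r x₁ x₂ x₃ =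
      (1 / (2 * ((m : ℝ) + 1))) * x₃ * (1 - x₃ ^ m) * (x₂ ^ ℓ + 1 / ((ℓ : ℝ) + 1))) :
    ∀ x₁ x₂ x₃ : ℝ,
      deriv (fun t => p t x₂ x₃) x₁ + deriv (fun t => q x₁ t x₃) x₂ +
        deriv (fun t => r x₁ x₂ t) x₃ = 0 := by
  intro x₁ x₂ x₃
  simp only [hp, hq, hr]
  rw [presup_aux, presup_aux]
  have e : (fun t : ℝ => t * x₂ ^ ℓ * x₃ ^ m - t / (((ℓ : ℝ) + 1) * ((m : ℝ) + 1))) =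
      fun t : ℝ => (x₂ ^ ℓ * x₃ ^ m - 1 / (((ℓ : ℝ) + 1) * ((m : ℝ) + 1))) * t := by
    funext t
    ring
  have h := ((hasDerivAt_id x₁).const_mul
    (x₂ ^ ℓ * x₃ ^ m - 1 / (((ℓ : ℝ) + 1) * ((m : ℝ) + 1)))).deriv
  simp only [id] at h
  rw [e, h]
  have h1 : (ℓ : ℝ) + 1 ≠ 0 := by positivity
  have h2 : (m : ℝ) + 1 ≠ 0 := by positivity
  field_simp
  ring
end

section
/- Let ν_{i,j} and c_j^i (i ∈ {1,3,5}, j ∈ {1,2,3}) be real numbers satisfying the face relations c_1^1 ν_{1,1} + c_2^1 ν_{1,2} + c_3^1 ν_{1,3} = ν_{1,1}, c_1^3 ν_{3,1} + c_2^3 ν_{3,2} + c_3^3 ν_{3,3} = ν_{3,2}, and c_1^5 ν_{5,1} + c_2^5 ν_{5,2} + c_3^5 ν_{5,3} = ν_{5,3}. Define the 9 × 9 real matrix A with rows: (ν_{1,1}, −ν_{1,2}, −ν_{1,3}, 0, ν_{3,1}, 0, 0, ν_{5,1}, 0); (0, ν_{1,2}, 0, ν_{3,2}, −ν_{3,1},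 −ν_{3,3}, 0, 0, ν_{5,2}); (0, 0, ν_{1,3}, 0, 0, ν_{3,3}, ν_{5,3}, −ν_{5,1}, −ν_{5,2}); (−c_2^1, 1, 0, 0, 0, 0, 0, 0, 0); (−c_3^1, 0, 1, 0, 0, 0, 0, 0, 0); (0, 0, 0, −c_1^3, 1, 0, 0, 0, 0); (0, 0, 0, −c_3^3, 0, 1, 0, 0, 0); (0, 0, 0, 0, 0, 0, −c_1^5, 1, 0); (0, 0, 0, 0, 0, 0, −c_2^5, 0, 1). Then A is invertible if and only if the matrix C∘H is invertible. -/
open Matrix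

/-- The 9 × 9 flux matrix of the basis `ψ₉*, ψ₁₀*, ψ₁₁*` together with the
six symmetric supplemental functions is invertible if and only if the 3 × 3 Hadamard matrix
`C∘H` (with `(j,i)`-entry `c_j^i ν_{i,j}`) is invertible.  Here `nij` denotes `ν_{i,j}` and
`cjfi` denotes `c_j^i`, and the face relations say that the centroid `c^i` lies on face `i`. -/
theorem symmetric_supplements_flux_matrix_invertible_iff
    (n11 n12 n13 n31 n32 n33 n51 n52 n53 : ℝ)
    (c1f1 c2f1 c3f1 c1f3 c2f3 c3f3 c1f5 c2f5 c3f5 : ℝ)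
    (hface1 : c1f1 * n11 + c2f1 * n12 + c3f1 * n13 = n11)
    (hface3 : c1f3 * n31 + c2f3 * n32 + c3f3 * n33 = n32)
    (hface5 : c1f5 * n51 + c2f5 * n52 + c3f5 * n53 = n53) :
    let A : Matrix (Fin 9) (Fin 9) ℝ :=
      !![n11, -n12, -n13, 0, n31, 0, 0, n51, 0;
         0, n12, 0, n32, -n31, -n33, 0, 0, n52;
         0, 0, n13, 0, 0, n33, n53, -n51, -n52;
         -c2f1, 1, 0, 0, 0, 0, 0, 0, 0;
         -c3f1, 0, 1, 0, 0, 0, 0, 0, 0;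
         0, 0, 0, -c1f3, 1, 0, 0, 0, 0;
         0, 0, 0, -c3f3, 0, 1, 0, 0, 0;
         0, 0, 0, 0, 0, 0, -c1f5, 1, 0;
         0, 0, 0, 0, 0, 0, -c2f5, 0, 1]
    let CH : Matrix (Fin 3) (Fin 3) ℝ :=
      !![c1f1 * n11, c1f3 * n31, c1f5 * n51;
         c2f1 * n12, c2f3 * n32, c2f5 * n52;
         c3f1 * n13, c3f3 * n33, c3f5 * n53]
    IsUnit A ↔ IsUnit CH := by
  intro A CH
  rw [Matrix.isUnit_iff_isUnit_det, Matrix.isUnit_iff_isUnit_det, isUnit_iff_ne_zero,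
    isUnit_iff_ne_zero, not_iff_not, ← Matrix.exists_mulVec_eq_zero_iff,
    ← Matrix.exists_mulVec_eq_zero_iff]
  constructor
  · rintro ⟨v, hv, h⟩
    have e0 := congrFun h 0
    have e1 := congrFun h 1
    have e2 := congrFun h 2
    have e3 := congrFun h 3
    have e4 := congrFun h 4
    have e5 := congrFun h 5
    have e6 := congrFun h 6
    have e7 := congrFun h 7
    have e8 := congrFun h 8
    simp [A, Matrix.mulVec, dotProduct, Fin.sum_univ_succ] at e0 e1 e2 e3 e4 e5 e6 e7 e8
    simp only [← Fin.succ_zero_eq_one, ← Fin.succ_one_eq_two] at *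
    change _ = (0 : ℝ) at e0
    have f1 : v 1 = c2f1 * v 0 := by change -(c2f1 * v 0) + v 1 = 0 at e3; linarith
    have f2 : v 2 = c3f1 * v 0 := by change -(c3f1 * v 0) + v 2 = 0 at e4; linarith
    have f4 : v 4 = c1f3 * v 3 := by change -(c1f3 * v 3) + v 4 = 0 at e5; linarith
    have f5 : v 5 = c3f3 * v 3 := by change -(c3f3 * v 3) + v 5 = 0 at e6; linarith
    have f7 : v 7 = c1f5 * v 6 := by change -(c1f5 * v 6) + v 7 = 0 at e7; linarith
    have f8 : v 8 = c2f5 * v 6 := by change -(c2f5 * v 6) + v 8 = 0 at e8; linarith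
    change n11 * v 0 + (-(n12 * v 1) + (-(n13 * v 2) + (n31 * v 4 + n51 * v 7))) = 0 at e0
    change n12 * v 1 + (n32 * v 3 + (-(n31 * v 4) + (-(n33 * v 5) + n52 * v 8))) = 0 at e1
    change n13 * v 2 + (n33 * v 5 + (n53 * v 6 + (-(n51 * v 7) + -(n52 * v 8)))) = 0 at e2
    rw [f1, f2, f4, f7] at e0
    rw [f1, f4, f5, f8] at e1
    rw [f2, f5, f7, f8] at e2
    refine ⟨![v 0, v 3, v 6], ?_, ?_⟩
    · intro h0
      apply hv
      have g0 : v 0 = 0 := congrFun h0 0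
      have g3 : v 3 = 0 := congrFun h0 1
      have g6 : v 6 = 0 := congrFun h0 2
      rw [g0, mul_zero] at f1 f2
      rw [g3, mul_zero] at f4 f5
      rw [g6, mul_zero] at f7 f8
      ext i
      fin_cases i <;> assumption
    · ext i
      fin_cases i <;> simp [CH, Matrix.mulVec, dotProduct, Fin.sum_univ_succ]
      · linear_combination e0 + v 0 * hface1
      · linear_combination e1 + v 3 * hface3
      · linear_combination e2 + v 6 * hface5
  · rintro ⟨w, hw, h⟩
    have e0 := congrFun h 0
    have e1 := congrFun h 1
    have e2 := congrFun h 2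
    simp [CH, Matrix.mulVec, dotProduct, Fin.sum_univ_three] at e0 e1 e2
    refine ⟨![w 0, c2f1 * w 0, c3f1 * w 0, w 1, c1f3 * w 1, c3f3 * w 1,
      w 2, c1f5 * w 2, c2f5 * w 2], ?_, ?_⟩
    · intro h0
      apply hw
      have g0 : w 0 = 0 := congrFun h0 0
      have g3 : w 1 = 0 := congrFun h0 3
      have g6 : w 2 = 0 := congrFun h0 6
      ext i
      fin_cases i <;> assumption
    · ext i
      fin_cases i <;> simp [A, Matrix.mulVec, dotProduct, Fin.sum_univ_succ]
      · linear_combination e0 - w 0 * hface1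
      · linear_combination e1 - w 1 * hface3
      · linear_combination e2 - w 2 * hface5
end

section
/- Let ν_{i,j} and c_j^i (i ∈ {1,3,5}, j ∈ {1,2,3}) be real numbers satisfying the face relations c_1^1 ν_{1,1} + c_2^1 ν_{1,2} + c_3^1 ν_{1,3} = ν_{1,1} and c_1^3 ν_{3,1} + c_2^3 ν_{3,2} + c_3^3 ν_{3,3} = ν_{3,2}, let f₁, f₃, f₅ be nonzero real numbers with ν_{5,3} ≠ 0, and let s, t be real numbers. Define the 9 × 9 real matrix A(s,t) with rows: (ν_{1,1}, −ν_{1,2}, −ν_{1,3}, 0, ν_{3,1}, 0, 0, ν_{5,1}, 0); (0, ν_{1,2}, 0, ν_{3,2}, −ν_{3,1}, −ν_{3,3}, 0, 0, ν_{5,2}); (0, 0, ν_{1,3}, 0, 0, ν_{3,3}, ν_{5,3}, −ν_{5,1}, −ν_{5,2}); (−c_2^1, 1, 0, 0, 0, 0, 0, 0, 0); (−c_3^1, 0, 1, 0, 0, 0, 0, 0, 0); (0, 0, 0, −c_1^3, 1, 0, 0, 0, 0); (0, 0, 0, −c_3^3, 0, 1, 0, 0, 0); ((−f₅ c_1^5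 + t)/f₁, 0, 0, −t/f₃, 0, 0, 0, 1, 0); (−s/f₁, 0, 0, (−f₅ c_2^5 + s)/f₃, 0, 0, 0, 0, 1). Then A(s,t) is invertible if and only if d(s,t) ≠ 0, where d(s,t) is the determinant of the 2 × 2 matrix with rows (c_1^1 ν_{1,1} + ν_{5,1}(f₅ c_1^5 − t)/f₁, c_1^3 ν_{3,1} + t ν_{5,1}/f₃) and (c_2^1 ν_{1,2} + s ν_{5,2}/f₁, c_2^3 ν_{3,2} + ν_{5,2}(f₅ c_2^5 − s)/f₃). -/
theorem sum_fin_nine_aux {M : Type*} [AddCommMonoid M] (f : Fin 9 → M) :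
    ∑ i, f i = f 0 + f 1 + f 2 + f 3 + f 4 + f 5 + f 6 + f 7 + f 8 := by
  rw [Fin.sum_univ_castSucc, Fin.sum_univ_eight]; rfl

open Matrix

/-- The 9 × 9 flux matrix `A(s,t)` of the basis `ψ₉*, ψ₁₀*, ψ₁₁*` together
with the non-symmetric supplemental functions is invertible if and only if the 2 × 2
determinant `d(s,t)` is nonzero.  Here `nij` denotes `ν_{i,j}` and `cjfi` denotes `c_j^i`. -/
theorem nonsymmetric_supplements_flux_matrix_invertible_iff
    (n11 n12 n13 n31 n32 n33 n51 n52 n53 : ℝ)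
    (c1f1 c2f1 c3f1 c1f3 c2f3 c3f3 c1f5 c2f5 c3f5 : ℝ)
    (f₁ f₃ f₅ : ℝ) (hf₁ : f₁ ≠ 0) (hf₃ : f₃ ≠ 0) (hf₅ : f₅ ≠ 0)
    (hn53 : n53 ≠ 0)
    (hface1 : c1f1 * n11 + c2f1 * n12 + c3f1 * n13 = n11)
    (hface3 : c1f3 * n31 + c2f3 * n32 + c3f3 * n33 = n32)
    (s t : ℝ) :
    let A : Matrix (Fin 9) (Fin 9) ℝ :=
      !![n11, -n12, -n13, 0, n31, 0, 0, n51, 0;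
         0, n12, 0, n32, -n31, -n33, 0, 0, n52;
         0, 0, n13, 0, 0, n33, n53, -n51, -n52;
         -c2f1, 1, 0, 0, 0, 0, 0, 0, 0;
         -c3f1, 0, 1, 0, 0, 0, 0, 0, 0;
         0, 0, 0, -c1f3, 1, 0, 0, 0, 0;
         0, 0, 0, -c3f3, 0, 1, 0, 0, 0;
         (-(f₅ * c1f5) + t) / f₁, 0, 0, -t / f₃, 0, 0, 0, 1, 0;
         -s / f₁, 0, 0, (-(f₅ * c2f5) + s) / f₃, 0, 0, 0, 0, 1]
    let d : ℝ :=
      (!![c1f1 * n11 + n51 * (f₅ * c1f5 - t) / f₁, c1f3 * n31 + t * n51 / f₃;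
          c2f1 * n12 + s * n52 / f₁, c2f3 * n32 + n52 * (f₅ * c2f5 - s) / f₃] :
        Matrix (Fin 2) (Fin 2) ℝ).det
    IsUnit A ↔ d ≠ 0 := by
  intro A d
  have key : A.det = 0 ↔ d = 0 := by
    rw [← Matrix.exists_mulVec_eq_zero_iff, ← Matrix.exists_mulVec_eq_zero_iff]
    constructor
    · rintro ⟨v, hv0, hv⟩
      have h0 := congrFun hv 0
      have h1 := congrFun hv 1
      have h2 := congrFun hv 2
      have h3 := congrFun hv 3
      have h4 := congrFun hv 4
      have h5 := congrFun hv 5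
      have h6 := congrFun hv 6
      have h7 := congrFun hv 7
      have h8 := congrFun hv 8
      clear hv
      simp only [A, Matrix.mulVec, dotProduct, sum_fin_nine_aux, Matrix.of_apply,
        Matrix.cons_val, Pi.zero_apply] at h0 h1 h2 h3 h4 h5 h6 h7 h8
      refine ⟨![v 0, v 3], ?_, ?_⟩
      · intro hw
        apply hv0
        have e0 : v 0 = 0 := by simpa using congrFun hw 0
        have e3 : v 3 = 0 := by simpa using congrFun hw 1
        rw [e0, e3] at h0 h1 h2 h3 h4 h5 h6 h7 h8
        have e1 : v 1 = 0 := by linarith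
        have e2 : v 2 = 0 := by linarith
        have e4 : v 4 = 0 := by linarith
        have e5 : v 5 = 0 := by linarith
        have e7 : v 7 = 0 := by linarith
        have e8 : v 8 = 0 := by linarith
        have e6 : v 6 = 0 := by
          rw [e2, e5, e7, e8] at h2
          have : n53 * v 6 = 0 := by linarith
          exact (mul_eq_zero.mp this).resolve_left hn53
        funext i
        fin_cases i <;> assumption
      · funext i
        fin_cases i
        · simp [Matrix.mulVec, dotProduct, Fin.sum_univ_two]
          linear_combination h0 + v 0 * hface1 + n12 * h3 + n13 * h4 - n31 * h5 - n51 * h7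
        · simp [Matrix.mulVec, dotProduct, Fin.sum_univ_two]
          linear_combination h1 + v 3 * hface3 - n12 * h3 + n31 * h5 + n33 * h6 - n52 * h8
    · rintro ⟨w, hw0, hw⟩
      have h0 := congrFun hw 0
      have h1 := congrFun hw 1
      simp [Matrix.mulVec, dotProduct, Fin.sum_univ_two] at h0 h1
      obtain ⟨x7, hx7⟩ : ∃ x, x = (f₅ * c1f5 - t) / f₁ * w 0 + t / f₃ * w 1 := ⟨_, rfl⟩
      obtain ⟨x8, hx8⟩ : ∃ x, x = s / f₁ * w 0 + (f₅ * c2f5 - s) / f₃ * w 1 := ⟨_, rfl⟩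
      obtain ⟨x6, hx6⟩ : ∃ x, n53 * x =
          n51 * x7 + n52 * x8 - n13 * (c3f1 * w 0) - n33 * (c3f3 * w 1) :=
        ⟨_, mul_div_cancel₀ _ hn53⟩
      refine ⟨![w 0, c2f1 * w 0, c3f1 * w 0, w 1, c1f3 * w 1, c3f3 * w 1, x6, x7, x8], ?_, ?_⟩
      · intro hv
        apply hw0
        have e0 : w 0 = 0 := congrFun hv 0
        have e1 : w 1 = 0 := congrFun hv 3
        funext i
        fin_cases i <;> assumption
      · funext i
        fin_cases i <;>
          simp only [A, Matrix.mulVec, dotProduct, sum_fin_nine_aux, Matrix.of_apply,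
            Matrix.cons_val, Pi.zero_apply, Fin.mk_one, Fin.zero_eta, Fin.reduceFinMk]
        · linear_combination h0 - w 0 * hface1 + n51 * hx7
        · linear_combination h1 - w 1 * hface3 + n52 * hx8
        · linear_combination hx6
        · ring
        · ring
        · ring
        · ring
        · linear_combination hx7
        · linear_combination hx8
  rw [Matrix.isUnit_iff_isUnit_det, isUnit_iff_ne_zero, ne_eq, ne_eq, key]
end

section
/- Let ν_{i,j} and c_j^i (i ∈ {1,3,5}, j ∈ {1,2,3}) be real numbers satisfying the face relations c_1^1 ν_{1,1} + c_2^1 ν_{1,2} + c_3^1 ν_{1,3} = ν_{1,1} and c_1^3 ν_{3,1} + c_2^3 ν_{3,2} + c_3^3 ν_{3,3} = ν_{3,2}. Let f₁, f₃, f₅ be strictly positive real numbers, assume ν_{5,3} ≠ 0, c_1^5 ≠ 0 and c_2^5 ≠ 0, assume f₁ c_1^1 ν_{1,1} + f₃ c_1^3 ν_{3,1} + f₅ c_1^5 ν_{5,1} ≠ 0 and f₁ c_2^1 ν_{1,2} + f₃ c_2^3 ν_{3,2} + f₅ c_2^5 ν_{5,2} ≠ 0, and assume that if ν_{5,1} =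 0 and ν_{5,2} = 0 then c_1^1 ν_{1,1} c_2^3 ν_{3,2} − c_1^3 ν_{3,1} c_2^1 ν_{1,2} ≠ 0. Then there exist real numbers s and t such that the 9 × 9 matrix A(s,t), with rows (ν_{1,1}, −ν_{1,2}, −ν_{1,3}, 0, ν_{3,1}, 0, 0, ν_{5,1}, 0); (0, ν_{1,2}, 0, ν_{3,2}, −ν_{3,1}, −ν_{3,3}, 0, 0, ν_{5,2}); (0, 0, ν_{1,3}, 0, 0, ν_{3,3}, ν_{5,3}, −ν_{5,1}, −ν_{5,2}); (−c_2^1, 1, 0, 0, 0, 0, 0, 0, 0); (−c_3^1, 0, 1, 0, 0, 0, 0, 0, 0); (0, 0, 0, −c_1^3, 1, 0, 0, 0, 0); (0, 0, 0, −c_3^3, 0, 1, 0, 0, 0); ((−f₅ c_1^5 + t)/f₁, 0, 0, −t/f₃, 0, 0, 0, 1, 0); (−s/f₁, 0, 0, (−f₅ c_2^5 + s)/f₃, 0, 0, 0, 0, 1), is invertible. -/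
open Matrix

/-- Under the stated hypotheses there exist real numbers `s` and `t`
making the 9 × 9 non-symmetric-supplement flux matrix `A(s,t)` invertible.
Here `nij` denotes `ν_{i,j}` and `cjfi` denotes `c_j^i`. -/
theorem nonsymmetric_supplements_exists_invertible
    (n11 n12 n13 n31 n32 n33 n51 n52 n53 : ℝ)
    (c1f1 c2f1 c3f1 c1f3 c2f3 c3f3 c1f5 c2f5 c3f5 : ℝ)
    (hface1 : c1f1 * n11 + c2f1 * n12 + c3f1 * n13 = n11)
    (hface3 : c1f3 * n31 + c2f3 * n32 + c3f3 * n33 = n32)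
    (f₁ f₃ f₅ : ℝ) (hf₁ : 0 < f₁) (hf₃ : 0 < f₃) (hf₅ : 0 < f₅)
    (hn53 : n53 ≠ 0) (hc1f5 : c1f5 ≠ 0) (hc2f5 : c2f5 ≠ 0)
    (hvol1 : f₁ * c1f1 * n11 + f₃ * c1f3 * n31 + f₅ * c1f5 * n51 ≠ 0)
    (hvol2 : f₁ * c2f1 * n12 + f₃ * c2f3 * n32 + f₅ * c2f5 * n52 ≠ 0)
    (hpillar : n51 = 0 → n52 = 0 →
      c1f1 * n11 * (c2f3 * n32) - c1f3 * n31 * (c2f1 * n12) ≠ 0) :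
    ∃ s t : ℝ,
      IsUnit (!![n11, -n12, -n13, 0, n31, 0, 0, n51, 0;
         0, n12, 0, n32, -n31, -n33, 0, 0, n52;
         0, 0, n13, 0, 0, n33, n53, -n51, -n52;
         -c2f1, 1, 0, 0, 0, 0, 0, 0, 0;
         -c3f1, 0, 1, 0, 0, 0, 0, 0, 0;
         0, 0, 0, -c1f3, 1, 0, 0, 0, 0;
         0, 0, 0, -c3f3, 0, 1, 0, 0, 0;
         (-(f₅ * c1f5) + t) / f₁, 0, 0, -t / f₃, 0, 0, 0, 1, 0;
         -s / f₁, 0, 0, (-(f₅ * c2f5) + s) / f₃, 0, 0, 0, 0, 1] :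
        Matrix (Fin 9) (Fin 9) ℝ) := by
  have hD : ∃ s t : ℝ,
      (f₁ * c1f1 * n11 + f₃ * c1f3 * n31 + f₅ * c1f5 * n51) *
        (f₃ * c2f3 * n32 + n52 * (f₅ * c2f5 - s)) -
      (f₁ * c2f1 * n12 + f₃ * c2f3 * n32 + f₅ * c2f5 * n52) *
        (f₃ * c1f3 * n31 + n51 * t) ≠ 0 := by
    by_cases h1 : n51 = 0
    · by_cases h2 : n52 = 0
      · refine ⟨0, 0, ?_⟩
        have h := mul_ne_zero (mul_ne_zero hf₁.ne' hf₃.ne') (hpillar h1 h2)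
        subst h1 h2
        intro h0
        apply h
        linear_combination h0
      · generalize f₁ * c1f1 * n11 + f₃ * c1f3 * n31 + f₅ * c1f5 * n51 = V1 at *
        generalize f₁ * c2f1 * n12 + f₃ * c2f3 * n32 + f₅ * c2f5 * n52 = V2 at *
        generalize f₃ * c2f3 * n32 = d at *
        generalize f₃ * c1f3 * n31 = b at *
        refine ⟨f₅ * c2f5 - ((1 + V2 * b) / V1 - d) / n52, 0, ?_⟩
        have : V1 * (d + n52 * (f₅ * c2f5 - (f₅ * c2f5 - ((1 + V2 * b) / V1 - d) / n52)))
            - V2 * (b + n51 * 0) = 1 := by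
          field_simp
          ring
        rw [this]
        exact one_ne_zero
    · generalize f₁ * c1f1 * n11 + f₃ * c1f3 * n31 + f₅ * c1f5 * n51 = V1 at *
      generalize f₁ * c2f1 * n12 + f₃ * c2f3 * n32 + f₅ * c2f5 * n52 = V2 at *
      generalize f₃ * c2f3 * n32 = d at *
      generalize f₃ * c1f3 * n31 = b at *
      refine ⟨f₅ * c2f5, ((V1 * d - 1) / V2 - b) / n51, ?_⟩
      have : V1 * (d + n52 * (f₅ * c2f5 - f₅ * c2f5))
          - V2 * (b + n51 * (((V1 * d - 1) / V2 - b) / n51)) = 1 := by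
        field_simp
        ring
      rw [this]
      exact one_ne_zero
  obtain ⟨s, t, hD⟩ := hD
  refine ⟨s, t, ?_⟩
  rw [Matrix.isUnit_iff_isUnit_det, isUnit_iff_ne_zero]
  intro hdet
  obtain ⟨v, hv, hmv⟩ := Matrix.exists_mulVec_eq_zero_iff.mpr hdet
  apply hv
  have e0 := congrFun hmv 0
  have e1 := congrFun hmv 1
  have e2 := congrFun hmv 2
  have e3 := congrFun hmv 3
  have e4 := congrFun hmv 4
  have e5 := congrFun hmv 5
  have e6 := congrFun hmv 6
  have e7 := congrFun hmv 7
  have e8 := congrFun hmv 8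
  clear hmv hdet hv
  simp [Matrix.mulVec, dotProduct, Fin.sum_univ_succ] at e0 e1 e2 e3 e4 e5 e6 e7 e8
  obtain ⟨x, hx⟩ : ∃ x, v 0 = f₁ * x := ⟨v 0 / f₁, by field_simp⟩
  obtain ⟨y, hy⟩ : ∃ y, v 3 = f₃ * y := ⟨v 3 / f₃, by field_simp⟩
  have h1 : v 1 = c2f1 * (f₁ * x) := by rw [← hx]; linarith
  have h2 : v 2 = c3f1 * (f₁ * x) := by rw [← hx]; linarith
  have h4 : v 4 = c1f3 * (f₃ * y) := by rw [← hy]; linarith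
  have h5 : v 5 = c3f3 * (f₃ * y) := by rw [← hy]; linarith
  have h7 : v 7 = (f₅ * c1f5 - t) * x + t * y := by
    rw [hx, hy] at e7
    field_simp at e7
    linarith
  have h8 : v 8 = s * x + (f₅ * c2f5 - s) * y := by
    rw [hx, hy] at e8
    field_simp at e8
    linarith
  rw [hx, h1, h2, h4, h7] at e0
  rw [hy, h1, h4, h5, h8] at e1
  have E0 : (f₁ * c1f1 * n11 + n51 * (f₅ * c1f5 - t)) * x
      + (f₃ * c1f3 * n31 + n51 * t) * y = 0 := by
    linear_combination e0 + f₁ * x * hface1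
  have E1 : (f₁ * c2f1 * n12 + n52 * s) * x
      + (f₃ * c2f3 * n32 + n52 * (f₅ * c2f5 - s)) * y = 0 := by
    linear_combination e1 + f₃ * y * hface3
  have hx0 : x = 0 := by
    refine (mul_eq_zero.mp ?_).resolve_left hD
    linear_combination (f₃ * c2f3 * n32 + n52 * (f₅ * c2f5 - s)) * E0
      - (f₃ * c1f3 * n31 + n51 * t) * E1
  have hy0 : y = 0 := by
    refine (mul_eq_zero.mp ?_).resolve_left hD
    linear_combination (f₁ * c1f1 * n11 + n51 * (f₅ * c1f5 - t)) * E1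
      - (f₁ * c2f1 * n12 + n52 * s) * E0
  subst hx0 hy0
  simp only [mul_zero, add_zero] at hx hy h1 h2 h4 h5 h7 h8
  have h6 : v 6 = 0 := by
    rw [h2, h5, h7, h8] at e2
    simpa [hn53] using e2
  funext i
  fin_cases i <;> simpa
end

section
/- Let ν_{i,j} and c_j^i (i ∈ {1,3,5}, j ∈ {1,2,3}) be real numbers such that all c_j^i > 0, ν_{5,1} = 0, ν_{5,2} = 0, ν_{5,3} > 0, ν_{1,1} > 0, ν_{3,2} > 0, ν_{1,1} ν_{3,2} − ν_{1,2} ν_{3,1} > 0, and c_1^1 c_2^3 − c_2^1 c_1^3 > 0. Then the matrix C∘H has strictly positive determinant; in particular it is invertible. -/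
open Matrix

/-- (Theorem a6, algebraic content.) If face 4 is parallel to face 5
(`ν_{5,1} = ν_{5,2} = 0`), all centroid coordinates are positive, `ν_{1,1}, ν_{3,2},
ν_{5,3} > 0`, the 2 × 2 normal minor `ν_{1,1}ν_{3,2} − ν_{1,2}ν_{3,1}` is positive, and
`c₁¹c₂³ − c₂¹c₁³ > 0`, then the Hadamard matrix `C∘H` has positive determinant; in particular
it is invertible.  Here `nij` denotes `ν_{i,j}` and `cjfi` denotes `c_j^i`. -/
theorem hadamard_matrix_invertible_parallel_faces
    (n11 n12 n13 n31 n32 n33 n51 n52 n53 : ℝ)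
    (c1f1 c2f1 c3f1 c1f3 c2f3 c3f3 c1f5 c2f5 c3f5 : ℝ)
    (hc : 0 < c1f1 ∧ 0 < c2f1 ∧ 0 < c3f1 ∧ 0 < c1f3 ∧ 0 < c2f3 ∧ 0 < c3f3 ∧
      0 < c1f5 ∧ 0 < c2f5 ∧ 0 < c3f5)
    (hn51 : n51 = 0) (hn52 : n52 = 0) (hn53 : 0 < n53)
    (hn11 : 0 < n11) (hn32 : 0 < n32)
    (hminor : 0 < n11 * n32 - n12 * n31)
    (hcminor : 0 < c1f1 * c2f3 - c2f1 * c1f3) :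
    let CH : Matrix (Fin 3) (Fin 3) ℝ :=
      !![c1f1 * n11, c1f3 * n31, c1f5 * n51;
         c2f1 * n12, c2f3 * n32, c2f5 * n52;
         c3f1 * n13, c3f3 * n33, c3f5 * n53]
    0 < CH.det ∧ IsUnit CH := by
  obtain ⟨h1, h2, h3, h4, h5, h6, h7, h8, h9⟩ := hc
  intro CH
  have hdet : CH.det = c3f5 * n53 * ((c1f1 * c2f3 - c2f1 * c1f3) * (n11 * n32)
      + (c2f1 * c1f3) * (n11 * n32 - n12 * n31)) := by
    simp only [CH, hn51, hn52, Matrix.det_fin_three]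
    simp
    ring
  have hpos : 0 < CH.det := by
    rw [hdet]
    exact mul_pos (mul_pos h9 hn53) (add_pos (mul_pos hcminor (mul_pos hn11 hn32))
      (mul_pos (mul_pos h2 h4) hminor))
  exact ⟨hpos, (Matrix.isUnit_iff_isUnit_det CH).2 (isUnit_iff_ne_zero.2 hpos.ne')⟩
end

section
/- Let ν_{i,j} and c_j^i (i ∈ {1,3,5}, j ∈ {1,2,3}) be real numbers such that all c_j^i > 0, ν_{1,3} = 0, ν_{3,3} = 0, ν_{5,3} > 0, ν_{1,1} > 0, ν_{3,2} > 0, ν_{1,1} ν_{3,2} − ν_{1,2} ν_{3,1} > 0, and c_1^1 c_2^3 − c_2^1 c_1^3 > 0. Then the matrix C∘H has strictly positive determinant; in particular it is invertible. -/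
open Matrix

/-- (Theorem pillar, algebraic content.) For a truncated vertical pillar
(`ν_{1,3} = ν_{3,3} = 0`), with all centroid coordinates positive, `ν_{1,1}, ν_{3,2},
ν_{5,3} > 0`, positive 2 × 2 normal minor `ν_{1,1}ν_{3,2} − ν_{1,2}ν_{3,1}`, and
`c₁¹c₂³ − c₂¹c₁³ > 0`, the Hadamard matrix `C∘H` has positive determinant; in particular it
is invertible.  Here `nij` denotes `ν_{i,j}` and `cjfi` denotes `c_j^i`. -/
theorem hadamard_matrix_invertible_truncated_pillar
    (n11 n12 n13 n31 n32 n33 n51 n52 n53 : ℝ)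
    (c1f1 c2f1 c3f1 c1f3 c2f3 c3f3 c1f5 c2f5 c3f5 : ℝ)
    (hc : 0 < c1f1 ∧ 0 < c2f1 ∧ 0 < c3f1 ∧ 0 < c1f3 ∧ 0 < c2f3 ∧ 0 < c3f3 ∧
      0 < c1f5 ∧ 0 < c2f5 ∧ 0 < c3f5)
    (hn13 : n13 = 0) (hn33 : n33 = 0) (hn53 : 0 < n53)
    (hn11 : 0 < n11) (hn32 : 0 < n32)
    (hminor : 0 < n11 * n32 - n12 * n31)
    (hcminor : 0 < c1f1 * c2f3 - c2f1 * c1f3) :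
    let CH : Matrix (Fin 3) (Fin 3) ℝ :=
      !![c1f1 * n11, c1f3 * n31, c1f5 * n51;
         c2f1 * n12, c2f3 * n32, c2f5 * n52;
         c3f1 * n13, c3f3 * n33, c3f5 * n53]
    0 < CH.det ∧ IsUnit CH := by
  intro CH
  obtain ⟨h1, h2, h3, h4, h5, h6, h7, h8, h9⟩ := hc
  have hdet : CH.det = c3f5 * n53 * ((c1f1 * c2f3 - c2f1 * c1f3) * (n11 * n32)
      + c2f1 * c1f3 * (n11 * n32 - n12 * n31)) := by
    simp only [CH, Matrix.det_fin_three, hn13, hn33]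
    simp
    ring
  have hpos : 0 < CH.det := by
    rw [hdet]
    exact mul_pos (mul_pos h9 hn53) (add_pos (mul_pos hcminor (mul_pos hn11 hn32))
      (mul_pos (mul_pos h2 h4) hminor))
  exact ⟨hpos, (Matrix.isUnit_iff_isUnit_det CH).2 (isUnit_iff_ne_zero.2 hpos.ne')⟩
end
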